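/- Let q, t ∈ (0,1), τ := log_q t, ζ₊ > 0, ζ₋ < 0, N ∈ ℤ_{≥1}. Suppose a ∈ ζ₊^{−1}q^ℤ, b ∈ ζ₋^{−1}q^ℤ (so b < 0 < a) and c = conj(d) ∈ ℂ∖ℝ. Then for every X ∈ Ω_N: M̃_N(X; q,t; a,b,c,d) is a nonnegative real; M̃_N(X; q,t; a,b,c,d) = 0 unless X ⊂ [b^{−1}q, a^{−1}q]; and M̃_N(X; q,t; a,b,c,d) > 0 whenever X ⊂ [b^{−1}q, a^{−1}q]. Moreover Z_N := Σ_{X∈Ω_N} M̃_N(X; q,t; a,b,c,d) is finite and strictly positive, so X ↦ M̃_N(X; q,t; a,b,c,d)/Z_N is a probability distribution on Ω_N supported exactly on the configurations contained in [b^{−1}q, a^{−1}q]. -/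

import Mathlib

/-- The infinite q-Pochhammer symbol `(u; q)_∞` (complex version). -/
noncomputable def qPochC (q : ℝ) (u : ℂ) : ℂ := ∏' n : ℕ, (1 - u * (q : ℂ) ^ n)

/-- The infinite q-Pochhammer symbol `(u; q)_∞` (real version). -/
noncomputable def qPochR (q u : ℝ) : ℝ := ∏' n : ℕ, (1 - u * q ^ n)

/-- The weight function `W(x; q; a,b,c,d) = (1-q)|x| (ax;q)_∞(bx;q)_∞ / ((cx;q)_∞(dx;q)_∞)`. -/
noncomputable def Wc (q : ℝ) (a b c d : ℂ) (x : ℝ) : ℂ :=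
  (((1 - q) * |x| : ℝ) : ℂ) * (qPochC q (a * x) * qPochC q (b * x)) /
    (qPochC q (c * x) * qPochC q (d * x))

/-- The theta function `θ_q(v) = (v;q)_∞ (q v⁻¹;q)_∞`. -/
noncomputable def thetaQ (q v : ℝ) : ℝ := qPochR q v * qPochR q (q * v⁻¹)

/-- `ψ_τ(u) = (-u)^{2τ-1} θ_q(tu)/θ_q(t u⁻¹)` with `τ = log_q t`. -/
noncomputable def psiQ (q t u : ℝ) : ℝ :=
  (-u) ^ (2 * Real.logb q t - 1) * thetaQ q (t * u) / thetaQ q (t * u⁻¹)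

/-- A (finite or countably infinite) particle configuration: a countable set of nonzero
reals, whose points can be enumerated from the outside toward 0 on each side, whose
outermost positive (resp. negative) point lies on `ζ₊ q^ℤ` (resp. `ζ₋ q^ℤ`), and in which
any two consecutive points of the same sign have ratio in `t q^{ℤ≥0}`. -/
def IsConfig (q t ζp ζm : ℝ) (X : Set ℝ) : Prop :=
  X.Countable ∧ (0 : ℝ) ∉ X ∧
  (∀ x ∈ X, 0 < x → {y ∈ X | x < y}.Finite) ∧
  (∀ x ∈ X, x < 0 → {y ∈ X | y < x}.Finite) ∧
  (∀ x ∈ X, 0 < x → (∀ y ∈ X, 0 < y → y ≤ x) → ∃ n : ℤ, x = ζp * q ^ n) ∧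
  (∀ x ∈ X, x < 0 → (∀ y ∈ X, y < 0 → x ≤ y) → ∃ n : ℤ, x = ζm * q ^ n) ∧
  (∀ x ∈ X, ∀ y ∈ X, 0 < y → y < x → (∀ z ∈ X, z ≤ y ∨ x ≤ z) → ∃ k : ℕ, y = x * t * q ^ k) ∧
  (∀ x ∈ X, ∀ y ∈ X, y < x → x < 0 → (∀ z ∈ X, z ≤ y ∨ x ≤ z) → ∃ k : ℕ, x = y * t * q ^ k)

/-- The set `Ω_N` of N-particle configurations, realized as finsets of reals. -/
def OmegaN (q t ζp ζm : ℝ) (N : ℕ) : Set (Finset ℝ) :=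
  {X | X.card = N ∧ IsConfig q t ζp ζm ↑X}

/-- The (q,t)-interaction `V_{q,t}(X)`. -/
noncomputable def Vqt (q t : ℝ) (X : Finset ℝ) : ℝ :=
  (∏ x ∈ X, ∏ y ∈ X, if y < x then (x - y) else 1) *
  (∏ x ∈ X, ∏ y ∈ X, if 0 < x ∧ y < x then
      x ^ (2 * Real.logb q t - 1) * qPochR q (q * t⁻¹ * y * x⁻¹) / qPochR q (t * y * x⁻¹)
    else 1) *
  (∏ x ∈ X, ∏ y ∈ X, if x < 0 ∧ y < x then
      |y| ^ (2 * Real.logb q t - 1) * qPochR q (q * t⁻¹ * x * y⁻¹) / qPochR q (t * x * y⁻¹)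
    else 1)

/-- The constant `C_N(k) = ∏_{1≤i<j≤N, i≤k} ψ_τ(ζ₋ζ₊⁻¹ t^{N-i-j+1})`. -/
noncomputable def CNconst (q t ζp ζm : ℝ) (N k : ℕ) : ℝ :=
  ∏ i ∈ Finset.Icc 1 N, ∏ j ∈ Finset.Icc 1 N,
    if i < j ∧ i ≤ k then psiQ q t (ζm * ζp⁻¹ * t ^ ((N : ℤ) - (i : ℤ) - (j : ℤ) + 1)) else 1

/-- The unnormalized N-particle weight
`M̃_N(X) = C_N(|X⁺|) V_{q,t}(X) ∏_{x∈X} W(x; q; a,b,c,d)`. -/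
noncomputable def Mtilde (q t ζp ζm : ℝ) (N : ℕ) (a b c d : ℂ) (X : Finset ℝ) : ℂ :=
  ((CNconst q t ζp ζm N (X.filter (fun x => 0 < x)).card * Vqt q t X : ℝ) : ℂ) *
    ∏ x ∈ X, Wc q a b c d x


open Filter Topology

lemma summable_mul_pow {q : ℝ} (hq0 : 0 < q) (hq1 : q < 1) (u : ℝ) :
    Summable fun n : ℕ => u * q ^ n :=
  (summable_geometric_of_lt_one hq0.le hq1).mul_left u

lemma qPochR_multipliable {q : ℝ} (hq0 : 0 < q) (hq1 : q < 1) (u : ℝ) :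
    Multipliable fun n : ℕ => 1 - u * q ^ n := by
  simpa [sub_eq_add_neg] using
    Real.multipliable_one_add_of_summable (summable_mul_pow hq0 hq1 u).neg

lemma qPochC_multipliable {q : ℝ} (hq0 : 0 < q) (hq1 : q < 1) (u : ℂ) :
    Multipliable fun n : ℕ => 1 - u * (q : ℂ) ^ n := by
  have h : Summable fun n : ℕ => -(u * (q : ℂ) ^ n) := by
    refine ((summable_geometric_of_norm_lt_one ?_).mul_left u).neg
    simpa [abs_of_pos hq0] using hq1
  simpa [sub_eq_add_neg] using Complex.multipliable_one_add_of_summable h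

lemma qPochR_tendsto {q : ℝ} (hq0 : 0 < q) (hq1 : q < 1) (u : ℝ) :
    Tendsto (fun n => ∏ i ∈ Finset.range n, (1 - u * q ^ i)) atTop (𝓝 (qPochR q u)) :=
  (qPochR_multipliable hq0 hq1 u).hasProd.tendsto_prod_nat

lemma qPochC_tendsto {q : ℝ} (hq0 : 0 < q) (hq1 : q < 1) (u : ℂ) :
    Tendsto (fun n => ∏ i ∈ Finset.range n, (1 - u * (q : ℂ) ^ i)) atTop (𝓝 (qPochC q u)) :=
  (qPochC_multipliable hq0 hq1 u).hasProd.tendsto_prod_nat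

lemma qPochC_ofReal {q : ℝ} (hq0 : 0 < q) (hq1 : q < 1) (u : ℝ) :
    qPochC q (u : ℂ) = (qPochR q u : ℂ) := by
  refine tendsto_nhds_unique (qPochC_tendsto hq0 hq1 u) ?_
  have := (Complex.continuous_ofReal.tendsto _).comp (qPochR_tendsto hq0 hq1 u)
  simpa [Function.comp_def] using this

lemma qPochC_conj {q : ℝ} (hq0 : 0 < q) (hq1 : q < 1) (u : ℂ) :
    qPochC q ((starRingEnd ℂ) u) = (starRingEnd ℂ) (qPochC q u) := by
  refine tendsto_nhds_unique (qPochC_tendsto hq0 hq1 _) ?_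
  have := (Complex.continuous_conj.tendsto _).comp (qPochC_tendsto hq0 hq1 u)
  simpa [Function.comp_def] using this

lemma qPochR_succ {q : ℝ} (hq0 : 0 < q) (hq1 : q < 1) (u : ℝ) :
    qPochR q u = (1 - u) * qPochR q (u * q) := by
  have h := ((qPochR_tendsto hq0 hq1 (u * q)).const_mul (1 - u))
  refine tendsto_nhds_unique ((qPochR_tendsto hq0 hq1 u).comp (tendsto_add_atTop_nat 1)) ?_
  refine h.congr fun n => ?_
  simp [Finset.prod_range_succ', mul_comm (1 - u), pow_succ', mul_assoc]

lemma qPochC_succ {q : ℝ} (hq0 : 0 < q) (hq1 : q < 1) (u : ℂ) :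
    qPochC q u = (1 - u) * qPochC q (u * q) := by
  have h := ((qPochC_tendsto hq0 hq1 (u * q)).const_mul (1 - u))
  refine tendsto_nhds_unique ((qPochC_tendsto hq0 hq1 u).comp (tendsto_add_atTop_nat 1)) ?_
  refine h.congr fun n => ?_
  simp [Finset.prod_range_succ', mul_comm (1 - u), pow_succ', mul_assoc]

lemma one_sub_mul_pow_pos {q u : ℝ} (hq0 : 0 < q) (hq1 : q < 1) (hu : u < 1) (n : ℕ) :
    0 < 1 - u * q ^ n := by
  have h1 : q ^ n ≤ 1 := pow_le_one₀ hq0.le hq1.le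
  have h2 : 0 < q ^ n := pow_pos hq0 n
  rcases le_total u 0 with h | h <;> nlinarith

lemma qPochR_pos {q u : ℝ} (hq0 : 0 < q) (hq1 : q < 1) (hu : u < 1) : 0 < qPochR q u := by
  have h : Summable fun n : ℕ => Real.log (1 - u * q ^ n) := by
    simpa [sub_eq_add_neg] using
      Real.summable_log_one_add_of_summable (summable_mul_pow hq0 hq1 u).neg
  rw [qPochR, ← Real.rexp_tsum_eq_tprod (one_sub_mul_pow_pos hq0 hq1 hu) h]
  exact Real.exp_pos _

lemma qPochR_anti {q u v : ℝ} (hq0 : 0 < q) (hq1 : q < 1) (huv : u ≤ v) (hv : v < 1) :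
    qPochR q v ≤ qPochR q u := by
  refine le_of_tendsto_of_tendsto' (qPochR_tendsto hq0 hq1 v) (qPochR_tendsto hq0 hq1 u)
    fun n => Finset.prod_le_prod (fun i _ => (one_sub_mul_pow_pos hq0 hq1 hv i).le) fun i _ => ?_
  have : 0 < q ^ i := pow_pos hq0 i
  nlinarith

lemma qPochR_zero (q : ℝ) : qPochR q 0 = 1 := by simp [qPochR]

lemma one_le_qPochR {q u : ℝ} (hq0 : 0 < q) (hq1 : q < 1) (hu : u ≤ 0) : 1 ≤ qPochR q u := by
  simpa [qPochR_zero] using qPochR_anti hq0 hq1 hu one_pos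

lemma qPochR_le_one {q u : ℝ} (hq0 : 0 < q) (hq1 : q < 1) (hu : 0 ≤ u) (hu1 : u < 1) :
    qPochR q u ≤ 1 := by
  simpa [qPochR_zero] using qPochR_anti hq0 hq1 hu hu1

lemma qPochR_le_norm_qPochC {q v : ℝ} (hq0 : 0 < q) (hq1 : q < 1) {u : ℂ} (huv : ‖u‖ ≤ v)
    (hv : v < 1) : qPochR q v ≤ ‖qPochC q u‖ := by
  refine le_of_tendsto_of_tendsto' (qPochR_tendsto hq0 hq1 v) (qPochC_tendsto hq0 hq1 u).norm
    fun n => ?_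
  rw [norm_prod]
  refine Finset.prod_le_prod (fun i _ => (one_sub_mul_pow_pos hq0 hq1 hv i).le) fun i _ => ?_
  have h0 : 0 < q ^ i := pow_pos hq0 i
  have h1 : ‖(1 : ℂ)‖ - ‖u * (q : ℂ) ^ i‖ ≤ ‖1 - u * (q : ℂ) ^ i‖ := norm_sub_norm_le _ _
  simp only [norm_one, norm_mul, norm_pow, Complex.norm_real, Real.norm_eq_abs,
    abs_of_pos hq0] at h1
  nlinarith

lemma qPochC_eq_zero {q : ℝ} (hq0 : 0 < q) (n : ℕ) : qPochC q ((q ^ n)⁻¹ : ℝ) = 0 := by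
  refine tprod_of_exists_eq_zero ⟨n, ?_⟩
  have : (q : ℂ) ≠ 0 := by exact_mod_cast hq0.ne'
  push_cast
  rw [inv_mul_cancel₀ (pow_ne_zero _ this), sub_self]

/-- On the line through `0` and a nonreal number, the distance to `1` is bounded below. -/
lemma le_norm_one_sub_mul_ofReal (c : ℂ) (x : ℝ) : |c.im| / ‖c‖ ≤ ‖1 - c * x‖ := by
  rcases eq_or_ne c 0 with rfl | hc
  · simp
  rw [div_le_iff₀ (norm_pos_iff.2 hc), ← Complex.norm_conj c, ← norm_mul]
  refine le_trans (le_of_eq ?_) (Complex.abs_im_le_norm _)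
  rw [← abs_neg]
  congr 1
  simp
  ring

lemma exists_pos_le_norm_qPochC {q : ℝ} (hq0 : 0 < q) (hq1 : q < 1) {c : ℂ} (hc : c.im ≠ 0)
    (R : ℝ) : ∃ m > 0, ∀ x : ℝ, |x| ≤ R → m ≤ ‖qPochC q (c * x)‖ := by
  have hc0 : c ≠ 0 := by rintro rfl; simp at hc
  have hcn : 0 < ‖c‖ := norm_pos_iff.2 hc0
  have hδ : 0 < |c.im| / ‖c‖ := div_pos (abs_pos.2 hc) hcn
  have key : ∀ n : ℕ, ∀ x : ℝ, ‖c‖ * |x| * q ^ n ≤ q →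
      (|c.im| / ‖c‖) ^ n * qPochR q q ≤ ‖qPochC q (c * x)‖ := by
    intro n
    induction n with
    | zero =>
      intro x hx
      simpa using qPochR_le_norm_qPochC hq0 hq1 (u := c * x) (by simpa using hx) hq1
    | succ n ih =>
      intro x hx
      rw [qPochC_succ hq0 hq1, norm_mul, pow_succ', mul_assoc]
      have h2 := ih (x * q) (by rw [abs_mul, abs_of_pos hq0]; rw [pow_succ] at hx; linarith)
      push_cast at h2
      rw [← mul_assoc] at h2
      exact mul_le_mul (le_norm_one_sub_mul_ofReal c x) h2
        (mul_nonneg (pow_nonneg hδ.le _) (qPochR_pos hq0 hq1 hq1).le) (norm_nonneg _)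
  have hlim : Tendsto (fun n : ℕ => ‖c‖ * R * q ^ n) atTop (𝓝 (‖c‖ * R * 0)) :=
    (tendsto_pow_atTop_nhds_zero_of_lt_one hq0.le hq1).const_mul _
  rw [mul_zero] at hlim
  obtain ⟨n, hn⟩ := (hlim.eventually_le_const hq0).exists
  refine ⟨_, mul_pos (pow_pos hδ n) (qPochR_pos hq0 hq1 hq1), fun x hx => key n x ?_⟩
  refine le_trans ?_ hn
  gcongr

lemma rpow_two_mul_logb_sub_one {q t : ℝ} (hq0 : 0 < q) (hq1 : q < 1) (ht0 : 0 < t) :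
    q ^ (2 * Real.logb q t - 1) = t ^ 2 / q := by
  rw [Real.rpow_sub hq0, Real.rpow_one, mul_comm, Real.rpow_mul hq0.le,
    Real.rpow_logb hq0 hq1.ne ht0]
  norm_cast

/-- Growth bound for the ratio of q-Pochhammer symbols at negative arguments. -/
lemma exists_qPochR_ratio_le {q t : ℝ} (hq0 : 0 < q) (hq1 : q < 1) (ht0 : 0 < t) :
    ∃ M > 0, ∀ r : ℝ, q ≤ r → qPochR q (-(q * t⁻¹ * r)) / qPochR q (-(t * r)) ≤
      M * r ^ (2 * Real.logb q t - 1) := by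
  set e := 2 * Real.logb q t - 1 with he
  set M := qPochR q (-(q * t⁻¹)) * qPochR q (-(t * q⁻¹)) * (q ^ |e|)⁻¹ with hM
  have hneg : ∀ {u : ℝ}, 0 ≤ u → 0 < qPochR q (-u) := fun hu =>
    qPochR_pos hq0 hq1 (by linarith)
  have hMpos : 0 < M := mul_pos (mul_pos (hneg (by positivity)) (hneg (by positivity)))
    (by positivity)
  refine ⟨M, hMpos, ?_⟩
  have base : ∀ r : ℝ, q ≤ r → r ≤ 1 → qPochR q (-(q * t⁻¹ * r)) / qPochR q (-(t * r)) *
      qPochR q (-(t * r⁻¹)) ≤ M * r ^ e := by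
    intro r hr hr1
    have hr0 : 0 < r := hq0.trans_le hr
    have h1 : qPochR q (-(q * t⁻¹ * r)) / qPochR q (-(t * r)) ≤ qPochR q (-(q * t⁻¹)) := by
      refine (div_le_self (hneg (by positivity)).le
        (one_le_qPochR hq0 hq1 (by simp; positivity))).trans ?_
      refine qPochR_anti hq0 hq1 (neg_le_neg (mul_le_of_le_one_right (by positivity) hr1)) ?_
      have : 0 < q * t⁻¹ * r := by positivity
      linarith
    have h2 : qPochR q (-(t * r⁻¹)) ≤ qPochR q (-(t * q⁻¹)) := by
      refine qPochR_anti hq0 hq1 (neg_le_neg (by gcongr)) ?_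
      have : 0 < t * r⁻¹ := by positivity
      linarith
    have h3 : q ^ |e| ≤ r ^ e :=
      (Real.rpow_le_rpow hq0.le hr (abs_nonneg e)).trans
        (Real.rpow_le_rpow_of_exponent_ge hr0 hr1 (le_abs_self e))
    calc _ ≤ qPochR q (-(q * t⁻¹)) * qPochR q (-(t * q⁻¹)) :=
          mul_le_mul h1 h2 (hneg (by positivity)).le (hneg (by positivity)).le
      _ = M * q ^ |e| := by
          have : q ^ |e| ≠ 0 := by positivity
          rw [hM]; field_simp
      _ ≤ _ := by gcongr
  have key : ∀ n : ℕ, ∀ r : ℝ, q ≤ r → r * q ^ n ≤ 1 →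
      qPochR q (-(q * t⁻¹ * r)) / qPochR q (-(t * r)) * qPochR q (-(t * r⁻¹)) ≤ M * r ^ e := by
    intro n
    induction n with
    | zero => intro r hr hr1; exact base r hr (by simpa using hr1)
    | succ n ih =>
      intro r hr hr1
      rcases le_total r 1 with h | h
      · exact base r hr h
      have hr0 : 0 < r := hq0.trans_le hr
      have hs := ih (r * q) (by nlinarith) (by rw [pow_succ] at hr1; linarith)
      rw [Real.mul_rpow hr0.le hq0.le, he, rpow_two_mul_logb_sub_one hq0 hq1 ht0, ← he] at hs
      have e1 := qPochR_succ hq0 hq1 (-(q * t⁻¹ * r))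
      have e2 := qPochR_succ hq0 hq1 (-(t * r))
      have e3 := qPochR_succ hq0 hq1 (-(t * (r * q)⁻¹))
      rw [show -(q * t⁻¹ * r) * q = -(q * t⁻¹ * (r * q)) by ring] at e1
      rw [show -(t * r) * q = -(t * (r * q)) by ring] at e2
      rw [show -(t * (r * q)⁻¹) * q = -(t * r⁻¹) by field_simp] at e3
      rw [e3] at hs
      rw [e1, e2]
      have hfac : (1 - -(q * t⁻¹ * r)) / (1 - -(t * r)) * (t ^ 2 / q) ≤
          1 - -(t * (r * q)⁻¹) := by
        have : 1 - -(t * (r * q)⁻¹) - (1 - -(q * t⁻¹ * r)) / (1 - -(t * r)) * (t ^ 2 / q) =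
          (r * q + t) / (r * q * (1 + t * r)) := by
          have h1 : 1 + t * r ≠ 0 := by positivity
          simp only [sub_neg_eq_add]
          field_simp
          ring
        have h2 : 0 < (r * q + t) / (r * q * (1 + t * r)) := by positivity
        linarith
      generalize hA : (1 - -(q * t⁻¹ * r)) / (1 - -(t * r)) = A at hfac
      have hA0 : 0 < A := by
        rw [← hA]; simp only [sub_neg_eq_add]; positivity
      have hB0 : 0 < 1 - -(t * (r * q)⁻¹) := by simp only [sub_neg_eq_add]; positivity
      generalize 1 - -(t * (r * q)⁻¹) = B at hs hfac hB0
      rw [mul_div_mul_comm, hA]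
      generalize qPochR q (-(q * t⁻¹ * (r * q))) / qPochR q (-(t * (r * q))) = F at hs
      generalize qPochR q (-(t * r⁻¹)) = Q at hs
      have hre : 0 < r ^ e := by positivity
      have : B * (A * F * Q) ≤ B * (M * r ^ e) := by
        calc B * (A * F * Q) = A * (F * (B * Q)) := by ring
          _ ≤ A * (M * (r ^ e * (t ^ 2 / q))) := by gcongr
          _ = A * (t ^ 2 / q) * (M * r ^ e) := by ring
          _ ≤ B * (M * r ^ e) := by gcongr
      exact le_of_mul_le_mul_left this hB0
  intro r hr
  have hr0 : 0 < r := hq0.trans_le hr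
  have hlim : Tendsto (fun n : ℕ => r * q ^ n) atTop (𝓝 (r * 0)) :=
    (tendsto_pow_atTop_nhds_zero_of_lt_one hq0.le hq1).const_mul _
  rw [mul_zero] at hlim
  obtain ⟨n, hn⟩ := (hlim.eventually_le_const one_pos).exists
  refine le_trans (le_mul_of_one_le_right ?_ (one_le_qPochR hq0 hq1 ?_)) (key n r hr hn)
  · exact (div_pos (hneg (by positivity)) (hneg (by positivity))).le
  · have : 0 < t * r⁻¹ := by positivity
    linarith

/-- Real form of the weight function when `c` and `d` are complex conjugate. -/
noncomputable def realWeight (q a b : ℝ) (c : ℂ) (x : ℝ) : ℝ :=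
  (1 - q) * |x| * (qPochR q (a * x) * qPochR q (b * x)) / ‖qPochC q (c * x)‖ ^ 2

lemma Wc_eq_realWeight {q : ℝ} (hq0 : 0 < q) (hq1 : q < 1) (a b : ℝ) {c d : ℂ}
    (hcd : c = (starRingEnd ℂ) d) (x : ℝ) :
    Wc q a b c d x = (realWeight q a b c x : ℂ) := by
  have hd : d * x = (starRingEnd ℂ) (c * x) := by simp [hcd]
  rw [Wc, hd, qPochC_conj hq0 hq1, Complex.mul_conj', ← Complex.ofReal_mul, ← Complex.ofReal_mul,
    qPochC_ofReal hq0 hq1, qPochC_ofReal hq0 hq1, realWeight]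
  push_cast
  ring

lemma norm_qPochC_pos {q : ℝ} (hq0 : 0 < q) (hq1 : q < 1) {c : ℂ} (hc : c.im ≠ 0) (x : ℝ) :
    0 < ‖qPochC q (c * x)‖ := by
  obtain ⟨m, hm, h⟩ := exists_pos_le_norm_qPochC hq0 hq1 hc |x|
  exact hm.trans_le (h x le_rfl)

lemma realWeight_pos {q a b : ℝ} (hq0 : 0 < q) (hq1 : q < 1) {c : ℂ} (hc : c.im ≠ 0) {x : ℝ}
    (hx : x ≠ 0) (ha : a * x < 1) (hb : b * x < 1) : 0 < realWeight q a b c x := by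
  have h1 := qPochR_pos hq0 hq1 ha
  have h2 := qPochR_pos hq0 hq1 hb
  have h3 := norm_qPochC_pos hq0 hq1 hc x
  have h4 : 0 < |x| := abs_pos.2 hx
  have h5 : 0 < 1 - q := by linarith
  rw [realWeight]
  positivity

lemma realWeight_eq_zero {q : ℝ} (hq0 : 0 < q) (hq1 : q < 1) {a b : ℝ} (c : ℂ) {x : ℝ}
    (h : ∃ i : ℕ, a * x = (q ^ i)⁻¹ ∨ b * x = (q ^ i)⁻¹) : realWeight q a b c x = 0 := by
  have hz : ∀ i : ℕ, qPochR q (q ^ i)⁻¹ = 0 := fun i => by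
    have := qPochC_eq_zero hq0 i
    rw [qPochC_ofReal hq0 hq1] at this
    exact_mod_cast this
  obtain ⟨i, h | h⟩ := h <;> simp [realWeight, h, hz]

lemma exists_realWeight_le {q : ℝ} (hq0 : 0 < q) (hq1 : q < 1) (a b : ℝ) {c : ℂ}
    (hc : c.im ≠ 0) (R : ℝ) :
    ∃ K > 0, ∀ x : ℝ, |x| ≤ R → a * x < 1 → b * x < 1 → realWeight q a b c x ≤ K * |x| := by
  obtain ⟨m, hm, h⟩ := exists_pos_le_norm_qPochC hq0 hq1 hc R
  have hP : ∀ a : ℝ, 0 < qPochR q (-(|a| * |R|)) := fun a =>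
    qPochR_pos hq0 hq1 (by linarith [mul_nonneg (abs_nonneg a) (abs_nonneg R)])
  have hq : 0 < 1 - q := by linarith
  refine ⟨(1 - q) * (qPochR q (-(|a| * |R|)) * qPochR q (-(|b| * |R|))) / m ^ 2, ?_, ?_⟩
  · have h1 := hP a
    have h2 := hP b
    positivity
  intro x hx hax hbx
  have bound : ∀ a : ℝ, a * x < 1 → qPochR q (a * x) ≤ qPochR q (-(|a| * |R|)) := by
    intro a hax
    refine qPochR_anti hq0 hq1 ?_ hax
    have h1 : |a * x| ≤ |a| * |R| := by
      rw [abs_mul]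
      exact mul_le_mul_of_nonneg_left (hx.trans (le_abs_self R)) (abs_nonneg a)
    linarith [neg_abs_le (a * x)]
  have h1 := bound a hax
  have h2 := bound b hbx
  have h3 := h x hx
  have h4 := (qPochR_pos hq0 hq1 hax).le
  have h5 := (qPochR_pos hq0 hq1 hbx).le
  have h6 := (hP a).le
  have h7 := mul_nonneg hq.le (abs_nonneg x)
  have h8 := mul_nonneg h7 (mul_nonneg h6 (hP b).le)
  calc realWeight q a b c x
      ≤ (1 - q) * |x| * (qPochR q (-(|a| * |R|)) * qPochR q (-(|b| * |R|))) / m ^ 2 := by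
        rw [realWeight]
        gcongr
    _ = _ := by ring

/-- Same-sign pair interactions are positive and bounded. -/
lemma pair_same_sign {q t : ℝ} (hq0 : 0 < q) (hq1 : q < 1) (ht0 : 0 < t) (ht1 : t < 1)
    {R x y : ℝ} (hy : 0 < y) (hyx : y ≤ t * x) (hxR : x ≤ R) :
    0 < (x - y) * (x ^ (2 * Real.logb q t - 1) * qPochR q (q * t⁻¹ * y * x⁻¹) /
      qPochR q (t * y * x⁻¹)) ∧
    (x - y) * (x ^ (2 * Real.logb q t - 1) * qPochR q (q * t⁻¹ * y * x⁻¹) /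
      qPochR q (t * y * x⁻¹)) ≤ R ^ (2 * Real.logb q t) / qPochR q t := by
  have hτ := Real.logb_pos_of_base_lt_one hq0 hq1 ht0 ht1
  set τ := Real.logb q t
  have hx : 0 < x := by
    by_contra h
    nlinarith
  have hlt : y < x := by nlinarith
  have hρ : y * x⁻¹ ≤ t := by rwa [← div_eq_mul_inv, div_le_iff₀ hx]
  have hρ0 : 0 < y * x⁻¹ := by positivity
  have hA : q * t⁻¹ * y * x⁻¹ ≤ q := by
    calc q * t⁻¹ * y * x⁻¹ = q * t⁻¹ * (y * x⁻¹) := by ring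
      _ ≤ q * t⁻¹ * t := by gcongr
      _ = q := by field_simp
  have hB : t * y * x⁻¹ ≤ t := by
    calc t * y * x⁻¹ = t * (y * x⁻¹) := by ring
      _ ≤ t * 1 := by gcongr; linarith
      _ = t := mul_one t
  have hA1 := qPochR_pos hq0 hq1 (hA.trans_lt hq1)
  have hB1 := qPochR_pos hq0 hq1 (hB.trans_lt ht1)
  have hA2 := qPochR_le_one hq0 hq1 (by positivity) (hA.trans_lt hq1)
  have hB2 := qPochR_anti hq0 hq1 hB ht1
  have ht := qPochR_pos hq0 hq1 ht1
  have hxy : 0 < x - y := by linarith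
  have hpow : x * x ^ (2 * τ - 1) = x ^ (2 * τ) := by
    rw [Real.rpow_sub_one hx.ne']
    field_simp
  refine ⟨by positivity, ?_⟩
  calc _ ≤ x * (x ^ (2 * τ - 1) * 1 / qPochR q t) := by gcongr; linarith
    _ = x ^ (2 * τ) / qPochR q t := by rw [← hpow]; ring
    _ ≤ _ := by gcongr

/-- Interactions between particles of opposite sign are positive and bounded. -/
lemma exists_pair_opposite_sign {q t : ℝ} (hq0 : 0 < q) (hq1 : q < 1) (ht0 : 0 < t)
    (ht1 : t < 1) (R : ℝ) :
    ∃ K : ℝ, ∀ x y : ℝ, 0 < x → y < 0 → x ≤ R → -y ≤ R →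
      0 < (x - y) * (x ^ (2 * Real.logb q t - 1) * qPochR q (q * t⁻¹ * y * x⁻¹) /
        qPochR q (t * y * x⁻¹)) ∧
      (x - y) * (x ^ (2 * Real.logb q t - 1) * qPochR q (q * t⁻¹ * y * x⁻¹) /
        qPochR q (t * y * x⁻¹)) ≤ K := by
  have hτ := Real.logb_pos_of_base_lt_one hq0 hq1 ht0 ht1
  obtain ⟨M, hM, hr⟩ := exists_qPochR_ratio_le hq0 hq1 ht0
  set τ := Real.logb q t
  refine ⟨max (2 * M) (2 * qPochR q (-(q * t⁻¹))) * R ^ (2 * τ), fun x y hx hy hxR hyR => ?_⟩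
  obtain ⟨s, rfl⟩ : ∃ s, y = -s := ⟨-y, by simp⟩
  have hs : 0 < s := by linarith
  have hR : 0 < R := by linarith
  have hpow : ∀ u : ℝ, 0 < u → u * u ^ (2 * τ - 1) = u ^ (2 * τ) := fun u hu => by
    rw [Real.rpow_sub_one hu.ne']
    field_simp
  rw [show q * t⁻¹ * -s * x⁻¹ = -(q * t⁻¹ * (s * x⁻¹)) by ring,
    show t * -s * x⁻¹ = -(t * (s * x⁻¹)) by ring, sub_neg_eq_add, mul_div_assoc]
  have hneg : ∀ {u : ℝ}, 0 ≤ u → 0 < qPochR q (-u) := fun hu =>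
    qPochR_pos hq0 hq1 (by linarith)
  have h1 : 0 < qPochR q (-(q * t⁻¹ * (s * x⁻¹))) := hneg (by positivity)
  have h2 : 0 < qPochR q (-(t * (s * x⁻¹))) := hneg (by positivity)
  refine ⟨by positivity, ?_⟩
  rcases le_total x s with h | h
  · have hr' := hr (s * x⁻¹) (hq1.le.trans (by rwa [← div_eq_mul_inv, one_le_div hx]))
    calc _ ≤ (s + s) * (x ^ (2 * τ - 1) * (M * (s * x⁻¹) ^ (2 * τ - 1))) := by gcongr
      _ = 2 * M * (s * s ^ (2 * τ - 1)) := by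
        rw [Real.mul_rpow hs.le (by positivity), Real.inv_rpow hx.le]
        field_simp
        ring
      _ = 2 * M * s ^ (2 * τ) := by rw [hpow s hs]
      _ ≤ _ := by gcongr; exacts [le_max_left _ _, by linarith]
  · have hle : s * x⁻¹ ≤ 1 := by rwa [← div_eq_mul_inv, div_le_one hx]
    have h3 : qPochR q (-(q * t⁻¹ * (s * x⁻¹))) / qPochR q (-(t * (s * x⁻¹))) ≤
        qPochR q (-(q * t⁻¹)) := by
      refine (div_le_self h1.le (one_le_qPochR hq0 hq1 (by simp; positivity))).trans ?_
      refine qPochR_anti hq0 hq1 (neg_le_neg (mul_le_of_le_one_right (by positivity) hle)) ?_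
      have : 0 < q * t⁻¹ * (s * x⁻¹) := by positivity
      linarith
    calc _ ≤ (x + x) * (x ^ (2 * τ - 1) * qPochR q (-(q * t⁻¹))) := by gcongr
      _ = 2 * qPochR q (-(q * t⁻¹)) * (x * x ^ (2 * τ - 1)) := by ring
      _ = 2 * qPochR q (-(q * t⁻¹)) * x ^ (2 * τ) := by rw [hpow x hx]
      _ ≤ _ := by gcongr; exact le_max_right _ _

/-- If consecutive positive points have ratio in `t q^{ℤ≥0}`, then any two positive points
have ratio in `t^{k+1} q^{ℤ≥0}`. -/
lemma exists_eq_mul_pow_of_consecutive {q t : ℝ} {X : Finset ℝ}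
    (hX : ∀ x ∈ X, ∀ y ∈ X, 0 < y → y < x → (∀ z ∈ X, z ≤ y ∨ x ≤ z) → ∃ k : ℕ, y = x * t * q ^ k)
    {x y : ℝ} (hx : x ∈ X) (hy : y ∈ X) (hy0 : 0 < y) (hyx : y < x) :
    ∃ k m : ℕ, y = x * t ^ (k + 1) * q ^ m := by
  induction h : (X.filter (y < ·)).card using Nat.strong_induction_on generalizing y with
  | _ n ih =>
    have hne : (X.filter (y < ·)).Nonempty := ⟨x, by simp [hx, hyx]⟩
    obtain ⟨hz, hyz⟩ := Finset.mem_filter.1 (Finset.min'_mem _ hne)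
    set z := (X.filter (y < ·)).min' hne
    obtain ⟨m, hm⟩ := hX z hz y hy hy0 hyz fun w hw => by
      by_contra! hc
      exact (Finset.min'_le _ w (Finset.mem_filter.2 ⟨hw, hc.1⟩)).not_gt hc.2
    have hzx : z ≤ x := Finset.min'_le _ x (by simp [hx, hyx])
    rcases hzx.eq_or_lt with heq | hlt
    · exact ⟨0, m, by rw [hm, heq]; ring⟩
    · have hss : X.filter (z < ·) ⊂ X.filter (y < ·) := by
        refine Finset.ssubset_iff_subset_ne.2 ⟨fun w hw => ?_, fun he => ?_⟩
        · rw [Finset.mem_filter] at hw ⊢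
          exact ⟨hw.1, hyz.trans hw.2⟩
        · have : z ∈ X.filter (z < ·) := by rw [he]; exact Finset.mem_filter.2 ⟨hz, hyz⟩
          simp at this
      obtain ⟨k, j, hkj⟩ := ih _ (h ▸ Finset.card_lt_card hss) hz (hy0.trans hyz) hlt rfl
      exact ⟨k + 1, j + m, by rw [hm, hkj]; ring⟩

/-- A point of a `q`-lattice either lies in the support, or at a zero of the weight. -/
lemma lattice_cases {q ζ α : ℝ} (hq0 : 0 < q) (hq1 : q < 1) (hζ : 0 < ζ)
    (hα : ∃ n : ℤ, α = ζ⁻¹ * q ^ n) (m : ℤ) :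
    (ζ * q ^ m ≤ α⁻¹ * q ∧ ∃ i : ℕ, ζ * q ^ m = α⁻¹ * q * q ^ i) ∨
      (α⁻¹ * q < ζ * q ^ m ∧ ∃ i : ℕ, α * (ζ * q ^ m) = (q ^ i)⁻¹) := by
  obtain ⟨n, rfl⟩ := hα
  have hinv : (ζ⁻¹ * q ^ n)⁻¹ * q = ζ * q ^ (1 - n) := by
    rw [zpow_sub₀ hq0.ne', zpow_one]
    field_simp
  rw [hinv]
  rcases le_or_gt (1 - n) m with h | h
  · refine Or.inl ⟨?_, (m - (1 - n)).toNat, ?_⟩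
    · exact mul_le_mul_of_nonneg_left (zpow_le_zpow_right_of_le_one₀ hq0 hq1.le h) hζ.le
    · rw [← zpow_natCast, Int.toNat_of_nonneg (by omega), mul_assoc, ← zpow_add₀ hq0.ne']
      congr 2
      ring
  · refine Or.inr ⟨?_, (-(n + m)).toNat, ?_⟩
    · exact mul_lt_mul_of_pos_left (zpow_lt_zpow_right_of_lt_one₀ hq0 hq1 h) hζ
    · rw [← zpow_natCast, Int.toNat_of_nonneg (by omega), zpow_neg, inv_inv, zpow_add₀ hq0.ne']
      field_simp

/-- Positions of the positive points of a configuration. -/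
lemma positive_points {q t ζ α : ℝ} (hq0 : 0 < q) (hq1 : q < 1) (ht0 : 0 < t) (ht1 : t < 1)
    (hζ : 0 < ζ) (hα : ∃ n : ℤ, α = ζ⁻¹ * q ^ n) {X : Finset ℝ}
    (htop : ∀ x ∈ X, 0 < x → (∀ y ∈ X, 0 < y → y ≤ x) → ∃ n : ℤ, x = ζ * q ^ n)
    (hX : ∀ x ∈ X, ∀ y ∈ X, 0 < y → y < x → (∀ z ∈ X, z ≤ y ∨ x ≤ z) →
      ∃ k : ℕ, y = x * t * q ^ k) :
    (∀ x ∈ X, ∀ y ∈ X, 0 < y → y < x → y ≤ t * x) ∧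
    ((∃ x ∈ X, α⁻¹ * q < x) → ∃ x ∈ X, ∃ i : ℕ, α * x = (q ^ i)⁻¹) ∧
    ((∀ x ∈ X, x ≤ α⁻¹ * q) → ∀ x ∈ X, 0 < x → ∃ k j : ℕ, x = α⁻¹ * q * t ^ k * q ^ j) := by
  have hα0 : 0 < α := by
    obtain ⟨n, rfl⟩ := hα
    positivity
  have hmax : ∀ x ∈ X, 0 < x → ∃ M ∈ X, x ≤ M ∧ (∃ m : ℤ, M = ζ * q ^ m) ∧
      ∃ k j : ℕ, x = M * t ^ k * q ^ j := by
    intro x hx hx0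
    have hne : X.Nonempty := ⟨x, hx⟩
    have hle : ∀ y ∈ X, y ≤ X.max' hne := fun y hy => X.le_max' y hy
    have hM := X.max'_mem hne
    refine ⟨X.max' hne, hM, hle x hx,
      htop _ hM (hx0.trans_le (hle x hx)) fun y hy _ => hle y hy, ?_⟩
    rcases (hle x hx).eq_or_lt with h | h
    · exact ⟨0, 0, by rw [pow_zero, pow_zero, mul_one, mul_one]; exact h⟩
    · obtain ⟨k, j, hkj⟩ := exists_eq_mul_pow_of_consecutive hX hM hx hx0 h
      exact ⟨k + 1, j, hkj⟩
  refine ⟨fun x hx y hy hy0 hyx => ?_, ?_, fun hle x hx hx0 => ?_⟩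
  · obtain ⟨k, m, rfl⟩ := exists_eq_mul_pow_of_consecutive hX hx hy hy0 hyx
    have hx0 : 0 < x := hy0.trans hyx
    have h1 : t ^ k ≤ 1 := pow_le_one₀ ht0.le ht1.le
    have h2 : q ^ m ≤ 1 := pow_le_one₀ hq0.le hq1.le
    calc x * t ^ (k + 1) * q ^ m = t * x * (t ^ k * q ^ m) := by ring
      _ ≤ t * x * 1 := by
        gcongr
        exact mul_le_one₀ h1 (by positivity) h2
      _ = t * x := mul_one _
  · rintro ⟨x, hx, hαx⟩
    obtain ⟨M, hM, hxM, ⟨m, rfl⟩, -⟩ := hmax x hx (lt_trans (by positivity) hαx)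
    rcases lattice_cases hq0 hq1 hζ hα m with h | h
    · exact absurd (hαx.trans_le hxM) h.1.not_gt
    · exact ⟨_, hM, h.2⟩
  · obtain ⟨M, hM, hxM, ⟨m, rfl⟩, k, j, rfl⟩ := hmax x hx hx0
    rcases lattice_cases hq0 hq1 hζ hα m with ⟨-, i, hi⟩ | h
    · exact ⟨k, i + j, by rw [hi]; ring⟩
    · exact absurd (hle _ hM) h.1.not_ge

/-- Positions of the negative points of a configuration, by reflection. -/
lemma negative_points {q t ζ β : ℝ} (hq0 : 0 < q) (hq1 : q < 1) (ht0 : 0 < t) (ht1 : t < 1)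
    (hζ : ζ < 0) (hβ : ∃ n : ℤ, β = ζ⁻¹ * q ^ n) {X : Finset ℝ}
    (htop : ∀ x ∈ X, x < 0 → (∀ y ∈ X, y < 0 → x ≤ y) → ∃ n : ℤ, x = ζ * q ^ n)
    (hX : ∀ x ∈ X, ∀ y ∈ X, y < x → x < 0 → (∀ z ∈ X, z ≤ y ∨ x ≤ z) →
      ∃ k : ℕ, x = y * t * q ^ k) :
    (∀ x ∈ X, ∀ y ∈ X, y < x → x < 0 → -x ≤ t * -y) ∧
    ((∃ x ∈ X, x < β⁻¹ * q) → ∃ x ∈ X, ∃ i : ℕ, β * x = (q ^ i)⁻¹) ∧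
    ((∀ x ∈ X, β⁻¹ * q ≤ x) → ∀ x ∈ X, x < 0 → ∃ k j : ℕ, x = β⁻¹ * q * t ^ k * q ^ j) := by
  have hmem : ∀ x, x ∈ X.image Neg.neg ↔ -x ∈ X := fun x => by simp [neg_eq_iff_eq_neg]
  have key := positive_points (ζ := -ζ) (α := -β) (X := X.image Neg.neg) hq0 hq1 ht0 ht1
    (by linarith) (hβ.imp fun n hn => by rw [hn, inv_neg]; ring) ?_ ?_
  · obtain ⟨h1, h2, h3⟩ := key
    rw [show (-β)⁻¹ * q = -(β⁻¹ * q) by rw [inv_neg]; ring] at h2 h3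
    refine ⟨fun x hx y hy hyx hx0 => ?_, ?_, fun hle x hx hx0 => ?_⟩
    · exact h1 (-y) (by simpa [hmem] using hy) (-x) (by simpa [hmem] using hx) (by linarith)
        (by linarith)
    · rintro ⟨x, hx, hlt⟩
      obtain ⟨y, hy, i, hi⟩ := h2 ⟨-x, by simpa [hmem] using hx, by linarith⟩
      exact ⟨-y, (hmem y).1 hy, i, by rw [← hi]; ring⟩
    · obtain ⟨k, j, hkj⟩ := h3 (fun y hy => by linarith [hle _ ((hmem y).1 hy)]) (-x)
        (by simpa [hmem] using hx) (by linarith)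
      exact ⟨k, j, by linear_combination -hkj⟩
  · intro x hx hx0 hmax
    obtain ⟨n, hn⟩ := htop (-x) ((hmem x).1 hx) (by linarith) fun y hy hy0 => by
      linarith [hmax (-y) (by simpa [hmem] using hy) (by linarith)]
    exact ⟨n, by linear_combination -hn⟩
  · intro x hx y hy hy0 hyx hcons
    obtain ⟨k, hk⟩ := hX (-y) ((hmem y).1 hy) (-x) ((hmem x).1 hx) (by linarith) (by linarith)
      fun z hz => by
        rcases hcons (-z) (by simpa [hmem] using hz) with h | h
        · exact Or.inr (by linarith)
        · exact Or.inl (by linarith)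
    exact ⟨k, by linear_combination -hk⟩

/-- The interaction of a configuration is positive and bounded. -/
lemma exists_Vqt_bound {q t : ℝ} (hq0 : 0 < q) (hq1 : q < 1) (ht0 : 0 < t) (ht1 : t < 1)
    (R : ℝ) : ∃ K > 0, ∀ X : Finset ℝ, (0 : ℝ) ∉ X →
      (∀ x ∈ X, ∀ y ∈ X, 0 < y → y < x → y ≤ t * x) →
      (∀ x ∈ X, ∀ y ∈ X, y < x → x < 0 → -x ≤ t * -y) →
      (∀ x ∈ X, |x| ≤ R) → 0 < Vqt q t X ∧ Vqt q t X ≤ (K ^ X.card) ^ X.card := by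
  obtain ⟨K, hK⟩ := exists_pair_opposite_sign hq0 hq1 ht0 ht1 R
  set B := R ^ (2 * Real.logb q t) / qPochR q t with hB
  set L := max 1 (max K B) with hL
  have hL1 : 1 ≤ L := le_max_left _ _
  have hLK : K ≤ L := (le_max_left _ _).trans (le_max_right _ _)
  have hLB : B ≤ L := (le_max_right _ _).trans (le_max_right _ _)
  refine ⟨L, by linarith, fun X h0 hpos hneg hR => ?_⟩
  have hterm : ∀ x ∈ X, ∀ y ∈ X, 0 < ((if y < x then (x - y) else 1) *
      (if 0 < x ∧ y < x then
        x ^ (2 * Real.logb q t - 1) * qPochR q (q * t⁻¹ * y * x⁻¹) / qPochR q (t * y * x⁻¹)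
        else 1) *
      (if x < 0 ∧ y < x then
        |y| ^ (2 * Real.logb q t - 1) * qPochR q (q * t⁻¹ * x * y⁻¹) / qPochR q (t * x * y⁻¹)
        else 1)) ∧ ((if y < x then (x - y) else 1) *
      (if 0 < x ∧ y < x then
        x ^ (2 * Real.logb q t - 1) * qPochR q (q * t⁻¹ * y * x⁻¹) / qPochR q (t * y * x⁻¹)
        else 1) *
      (if x < 0 ∧ y < x then
        |y| ^ (2 * Real.logb q t - 1) * qPochR q (q * t⁻¹ * x * y⁻¹) / qPochR q (t * x * y⁻¹)
        else 1)) ≤ L := by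
    intro x hx y hy
    by_cases hyx : y < x
    swap
    · simp [hyx, hL1]
    have hxR := abs_le.1 (hR x hx)
    have hyR := abs_le.1 (hR y hy)
    rcases lt_trichotomy x 0 with hx0 | hx0 | hx0
    · obtain ⟨h1, h2⟩ := pair_same_sign hq0 hq1 ht0 ht1 (x := -y) (y := -x) (R := R)
        (by linarith) (hneg x hx y hy hyx hx0) (by linarith)
      rw [show -y - -x = x - y by ring, show q * t⁻¹ * -x * (-y)⁻¹ = q * t⁻¹ * x * y⁻¹ by
        rw [inv_neg]; ring, show t * -x * (-y)⁻¹ = t * x * y⁻¹ by rw [inv_neg]; ring] at h1 h2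
      simp only [hyx, hx0, hx0.not_gt, abs_of_neg (hyx.trans hx0), if_true, and_self, false_and,
        if_false, mul_one]
      exact ⟨h1, h2.trans hLB⟩
    · exact absurd (hx0 ▸ hx) h0
    · simp only [hyx, hx0, hx0.not_gt, if_true, and_self, false_and, if_false, mul_one]
      rcases lt_trichotomy y 0 with hy0 | hy0 | hy0
      · obtain ⟨h1, h2⟩ := hK x y hx0 hy0 hxR.2 (by linarith)
        exact ⟨h1, h2.trans hLK⟩
      · exact absurd (hy0 ▸ hy) h0
      · obtain ⟨h1, h2⟩ := pair_same_sign hq0 hq1 ht0 ht1 hy0 (hpos x hx y hy hy0 hyx) hxR.2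
        exact ⟨h1, h2.trans hLB⟩
  simp only [Vqt, ← Finset.prod_mul_distrib]
  refine ⟨Finset.prod_pos fun x hx => Finset.prod_pos fun y hy => (hterm x hx y hy).1, ?_⟩
  refine (Finset.prod_le_prod (g := fun _ => L ^ X.card)
    (fun x hx => Finset.prod_nonneg fun y hy => (hterm x hx y hy).1.le) fun x hx => ?_).trans_eq
    (by simp)
  exact (Finset.prod_le_prod (g := fun _ => L) (fun y hy => (hterm x hx y hy).1.le)
    fun y hy => (hterm x hx y hy).2).trans_eq (by simp)

lemma psiQ_pos {q t u : ℝ} (hq0 : 0 < q) (hq1 : q < 1) (ht0 : 0 < t) (hu : u < 0) :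
    0 < psiQ q t u := by
  have hθ : ∀ v : ℝ, v < 0 → 0 < thetaQ q v := fun v hv =>
    mul_pos (qPochR_pos hq0 hq1 (by linarith))
      (qPochR_pos hq0 hq1 (by nlinarith [inv_lt_zero.2 hv]))
  exact div_pos (mul_pos (Real.rpow_pos_of_pos (by linarith) _)
    (hθ _ (mul_neg_of_pos_of_neg ht0 hu)))
    (hθ _ (mul_neg_of_pos_of_neg ht0 (inv_lt_zero.2 hu)))

lemma CNconst_pos {q t ζp ζm : ℝ} (hq0 : 0 < q) (hq1 : q < 1) (ht0 : 0 < t)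
    (hζp : 0 < ζp) (hζm : ζm < 0) (N k : ℕ) : 0 < CNconst q t ζp ζm N k := by
  refine Finset.prod_pos fun i _ => Finset.prod_pos fun j _ => ?_
  split_ifs
  · exact psiQ_pos hq0 hq1 ht0
      (mul_neg_of_neg_of_pos (mul_neg_of_neg_of_pos hζm (inv_pos.2 hζp)) (zpow_pos ht0 _))
  · exact one_pos

lemma summable_indicator_range {ι : Type*} {g : ι → ℝ} (hg : Summable fun i => |g i|) :
    Summable ((Set.range g).indicator fun x : ℝ => |x|) := by
  rw [← summable_subtype_iff_indicator]
  have := hg.comp_injective (Set.rangeSplitting_injective g)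
  refine this.congr fun y => ?_
  simp [Set.apply_rangeSplitting]

lemma summable_two_geometric {q t : ℝ} (hq0 : 0 < q) (hq1 : q < 1) (ht0 : 0 < t) (ht1 : t < 1)
    (A : ℝ) : Summable fun p : ℕ × ℕ => |A * t ^ p.1 * q ^ p.2| := by
  have h := (summable_geometric_of_lt_one ht0.le ht1).mul_of_nonneg
    (summable_geometric_of_lt_one hq0.le hq1) (fun _ => pow_nonneg ht0.le _)
    (fun _ => pow_nonneg hq0.le _)
  refine (h.mul_left |A|).congr fun p => ?_
  rw [abs_mul, abs_mul, abs_of_pos (pow_pos ht0 _), abs_of_pos (pow_pos hq0 _), mul_assoc]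

/-- The densely packed configuration `{A, A t, …, A t^{N-1}}`. -/
lemma exists_mem_OmegaN {q t ζp : ℝ} (ζm : ℝ) (ht0 : 0 < t) (ht1 : t < 1)
    {A : ℝ} (hA0 : 0 < A) (hA : ∃ n : ℤ, A = ζp * q ^ n) {N : ℕ} (hN : 1 ≤ N) :
    ∃ X ∈ OmegaN q t ζp ζm N, ∀ x ∈ X, 0 < x ∧ x ≤ A := by
  have hanti : StrictAnti fun i : ℕ => A * t ^ i := fun i j hij =>
    mul_lt_mul_of_pos_left (pow_lt_pow_right_of_lt_one₀ ht0 ht1 hij) hA0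
  set X := (Finset.range N).image fun i : ℕ => A * t ^ i with hX
  have hmem : ∀ x, x ∈ X ↔ ∃ i < N, A * t ^ i = x := fun x => by simp [hX]
  have hpos : ∀ x ∈ X, 0 < x ∧ x ≤ A := fun x hx => by
    obtain ⟨i, -, rfl⟩ := (hmem x).1 hx
    exact ⟨by positivity, mul_le_of_le_one_right hA0.le (pow_le_one₀ ht0.le ht1.le)⟩
  refine ⟨X, ⟨?_, X.countable_toSet, fun h => (hpos 0 h).1.ne rfl,
    fun x _ _ => X.finite_toSet.subset fun y hy => hy.1,
    fun x _ _ => X.finite_toSet.subset fun y hy => hy.1, fun x hx _ hmax => ?_,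
    fun x hx hx0 => absurd (hpos x hx).1 hx0.not_gt, fun x hx y hy _ hyx hcons => ?_,
    fun x hx _ _ _ hx0 => absurd (hpos x hx).1 hx0.not_gt⟩, hpos⟩
  · rw [hX, Finset.card_image_of_injective _ hanti.injective, Finset.card_range]
  · have hAX : A ∈ X := (hmem A).2 ⟨0, by omega, by simp⟩
    rwa [le_antisymm (hpos x hx).2 (hmax A hAX hA0)]
  · obtain ⟨i, hi, rfl⟩ := (hmem x).1 hx
    obtain ⟨j, hj, rfl⟩ := (hmem y).1 hy
    have hij : i < j := hanti.lt_iff_gt.1 hyx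
    refine ⟨0, ?_⟩
    rcases hcons (A * t ^ (i + 1)) ((hmem _).2 ⟨i + 1, by omega, rfl⟩) with h | h
    · have : j = i + 1 := le_antisymm (hanti.le_iff_ge.1 h) hij
      rw [this]
      ring
    · exact absurd (hanti (Nat.lt_succ_self i)) h.not_gt

lemma Mtilde_eq_ofReal {q : ℝ} (hq0 : 0 < q) (hq1 : q < 1) (t ζp ζm : ℝ) (N : ℕ) (a b : ℝ)
    {c d : ℂ} (hcd : c = (starRingEnd ℂ) d) (X : Finset ℝ) :
    Mtilde q t ζp ζm N a b c d X = ((CNconst q t ζp ζm N (X.filter (fun x => 0 < x)).card *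
      Vqt q t X * ∏ x ∈ X, realWeight q a b c x : ℝ) : ℂ) := by
  simp only [Mtilde, Wc_eq_realWeight hq0 hq1 a b hcd]
  push_cast
  ring

/-- Degenerate series, N particles: for `a ∈ ζ₊⁻¹ q^ℤ`, `b ∈ ζ₋⁻¹ q^ℤ` and
`c = conj d ∈ ℂ∖ℝ`, every weight `M̃_N(X)` is a nonnegative real, vanishing unless
`X ⊂ [b⁻¹q, a⁻¹q]` and strictly positive when `X ⊂ [b⁻¹q, a⁻¹q]`; the total sum `Z_N`
is finite and strictly positive, and the normalized weights form a probability
distribution supported exactly on the configurations contained in `[b⁻¹q, a⁻¹q]`. -/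
theorem stmt11 (q t ζp ζm : ℝ) (hq0 : 0 < q) (hq1 : q < 1) (ht0 : 0 < t) (ht1 : t < 1)
    (hζp : 0 < ζp) (hζm : ζm < 0) (N : ℕ) (hN : 1 ≤ N)
    (a b : ℝ) (ha : ∃ n : ℤ, a = ζp⁻¹ * q ^ n) (hb : ∃ n : ℤ, b = ζm⁻¹ * q ^ n)
    (c d : ℂ) (hcd : c = (starRingEnd ℂ) d) (hc : c.im ≠ 0) :
    (∀ X ∈ OmegaN q t ζp ζm N,
      ((Mtilde q t ζp ζm N (a : ℂ) (b : ℂ) c d X).im = 0 ∧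
        0 ≤ (Mtilde q t ζp ζm N (a : ℂ) (b : ℂ) c d X).re) ∧
      (¬ (↑X : Set ℝ) ⊆ Set.Icc (b⁻¹ * q) (a⁻¹ * q) →
        Mtilde q t ζp ζm N (a : ℂ) (b : ℂ) c d X = 0) ∧
      ((↑X : Set ℝ) ⊆ Set.Icc (b⁻¹ * q) (a⁻¹ * q) →
        0 < (Mtilde q t ζp ζm N (a : ℂ) (b : ℂ) c d X).re)) ∧
    Summable (fun X : OmegaN q t ζp ζm N =>
      (Mtilde q t ζp ζm N (a : ℂ) (b : ℂ) c d (X : Finset ℝ)).re) ∧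
    0 < (∑' X : OmegaN q t ζp ζm N,
      (Mtilde q t ζp ζm N (a : ℂ) (b : ℂ) c d (X : Finset ℝ)).re) ∧
    (∀ X : OmegaN q t ζp ζm N,
      (0 < (Mtilde q t ζp ζm N (a : ℂ) (b : ℂ) c d (X : Finset ℝ)).re /
          (∑' Y : OmegaN q t ζp ζm N,
            (Mtilde q t ζp ζm N (a : ℂ) (b : ℂ) c d (Y : Finset ℝ)).re)) ↔
        ((X : Finset ℝ) : Set ℝ) ⊆ Set.Icc (b⁻¹ * q) (a⁻¹ * q)) ∧
    ∑' X : OmegaN q t ζp ζm N,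
      (Mtilde q t ζp ζm N (a : ℂ) (b : ℂ) c d (X : Finset ℝ)).re /
        (∑' Y : OmegaN q t ζp ζm N,
          (Mtilde q t ζp ζm N (a : ℂ) (b : ℂ) c d (Y : Finset ℝ)).re) = 1 := by
  have ha0 : 0 < a := by
    obtain ⟨n, rfl⟩ := ha
    positivity
  have hb0 : b < 0 := by
    obtain ⟨n, rfl⟩ := hb
    exact mul_neg_of_neg_of_pos (inv_lt_zero.2 hζm) (zpow_pos hq0 n)
  set A := a⁻¹ * q with hA
  set B := b⁻¹ * q with hB
  have hA0 : 0 < A := by positivity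
  have hB0 : B < 0 := mul_neg_of_neg_of_pos (inv_lt_zero.2 hb0) hq0
  have hax : ∀ x ∈ Set.Icc B A, a * x < 1 := fun x hx => by
    have : a * x ≤ a * A := mul_le_mul_of_nonneg_left hx.2 ha0.le
    rw [hA, mul_inv_cancel_left₀ ha0.ne'] at this
    linarith
  have hbx : ∀ x ∈ Set.Icc B A, b * x < 1 := fun x hx => by
    have : b * x ≤ b * B := mul_le_mul_of_nonpos_left hx.1 hb0.le
    rw [hB, mul_inv_cancel_left₀ hb0.ne] at this
    linarith
  obtain ⟨K, hK0, hK⟩ := exists_Vqt_bound hq0 hq1 ht0 ht1 (max A (-B))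
  obtain ⟨D, hD0, hD⟩ := exists_realWeight_le hq0 hq1 a b hc (max A (-B))
  have habs : ∀ x ∈ Set.Icc B A, |x| ≤ max A (-B) := fun x hx =>
    abs_le.2 ⟨by linarith [hx.1, le_max_right A (-B)], hx.2.trans (le_max_left _ _)⟩
  set W : Finset ℝ → ℝ := fun X => (Mtilde q t ζp ζm N a b c d X).re with hW
  have hWeq : ∀ X, W X = CNconst q t ζp ζm N (X.filter (fun x => 0 < x)).card *
      Vqt q t X * ∏ x ∈ X, realWeight q a b c x := fun X => by
    rw [hW]
    simp only [Mtilde_eq_ofReal hq0 hq1 t ζp ζm N a b hcd X, Complex.ofReal_re]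
  have hpn : ∀ X ∈ OmegaN q t ζp ζm N, _ ∧ _ := fun X hX =>
    And.intro (positive_points hq0 hq1 ht0 ht1 hζp ha hX.2.2.2.2.2.1 hX.2.2.2.2.2.2.2.1)
      (negative_points hq0 hq1 ht0 ht1 hζm hb hX.2.2.2.2.2.2.1 hX.2.2.2.2.2.2.2.2)
  have hVpos : ∀ X ∈ OmegaN q t ζp ζm N, (↑X : Set ℝ) ⊆ Set.Icc B A →
      0 < Vqt q t X ∧ Vqt q t X ≤ (K ^ X.card) ^ X.card := fun X hX hsub =>
    hK X hX.2.2.1 (hpn X hX).1.1 (hpn X hX).2.1 fun x hx => habs x (hsub hx)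
  have hzero : ∀ X ∈ OmegaN q t ζp ζm N, ¬ (↑X : Set ℝ) ⊆ Set.Icc B A →
      Mtilde q t ζp ζm N a b c d X = 0 := by
    intro X hX hsub
    have hex : ∃ x ∈ X, ∃ i : ℕ, a * x = (q ^ i)⁻¹ ∨ b * x = (q ^ i)⁻¹ := by
      obtain ⟨x, hx, hxI⟩ := Set.not_subset.1 hsub
      rw [Set.mem_Icc, not_and_or, not_le, not_le] at hxI
      rcases hxI with h | h
      · obtain ⟨y, hy, i, hi⟩ := (hpn X hX).2.2.1 ⟨x, hx, h⟩
        exact ⟨y, hy, i, Or.inr hi⟩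
      · obtain ⟨y, hy, i, hi⟩ := (hpn X hX).1.2.1 ⟨x, hx, h⟩
        exact ⟨y, hy, i, Or.inl hi⟩
    obtain ⟨x, hx, hi⟩ := hex
    rw [Mtilde_eq_ofReal hq0 hq1 t ζp ζm N a b hcd X,
      Finset.prod_eq_zero hx (realWeight_eq_zero hq0 hq1 c hi)]
    simp
  have hwpos : ∀ X ∈ OmegaN q t ζp ζm N, (↑X : Set ℝ) ⊆ Set.Icc B A → ∀ x ∈ X,
      0 < realWeight q a b c x := fun X hX hsub x hx =>
    realWeight_pos hq0 hq1 hc (fun h => hX.2.2.1 (h ▸ hx)) (hax x (hsub hx)) (hbx x (hsub hx))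
  have hpos : ∀ X ∈ OmegaN q t ζp ζm N, (↑X : Set ℝ) ⊆ Set.Icc B A → 0 < W X := by
    intro X hX hsub
    rw [hWeq]
    exact mul_pos (mul_pos (CNconst_pos hq0 hq1 ht0 hζp hζm _ _) (hVpos X hX hsub).1)
      (Finset.prod_pos (hwpos X hX hsub))
  have hnonneg : ∀ X ∈ OmegaN q t ζp ζm N, 0 ≤ W X := by
    intro X hX
    by_cases hsub : (↑X : Set ℝ) ⊆ Set.Icc B A
    · exact (hpos X hX hsub).le
    · simp [hW, hzero X hX hsub]
  have hsum : Summable fun X : OmegaN q t ζp ζm N => W X := by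
    set f : ℝ → ℝ := fun x =>
      (Set.range fun p : ℕ × ℕ => A * t ^ p.1 * q ^ p.2).indicator (fun x : ℝ => |x|) x +
      (Set.range fun p : ℕ × ℕ => B * t ^ p.1 * q ^ p.2).indicator (fun x : ℝ => |x|) x with hf
    have hf0 : ∀ x, 0 ≤ f x := fun x =>
      add_nonneg (Set.indicator_nonneg (fun _ _ => abs_nonneg _) _)
        (Set.indicator_nonneg (fun _ _ => abs_nonneg _) _)
    have hfs : Summable f :=
      (summable_indicator_range (summable_two_geometric hq0 hq1 ht0 ht1 A)).add
        (summable_indicator_range (summable_two_geometric hq0 hq1 ht0 ht1 B))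
    have hprod := (summable_finsetProd_of_summable_nonneg hf0 hfs).comp_injective
      (Subtype.val_injective (p := (· ∈ OmegaN q t ζp ζm N)))
    set E := ∑ k ∈ Finset.range (N + 1), CNconst q t ζp ζm N k with hE
    refine Summable.of_nonneg_of_le (fun X => hnonneg X X.2) ?_
      (hprod.mul_left (E * (K ^ N) ^ N * D ^ N))
    rintro ⟨X, hX⟩
    have hE0 : 0 ≤ E := Finset.sum_nonneg fun k _ => (CNconst_pos hq0 hq1 ht0 hζp hζm N k).le
    have hcard : X.card = N := hX.1
    have hfp : 0 ≤ ∏ x ∈ X, f x := Finset.prod_nonneg fun x _ => hf0 x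
    by_cases hsub : (↑X : Set ℝ) ⊆ Set.Icc B A
    swap
    · simp only [hW, hzero X hX hsub, Complex.zero_re, Function.comp]
      positivity
    have hxf : ∀ x ∈ X, |x| ≤ f x := by
      intro x hx
      rcases lt_trichotomy x 0 with hx0 | hx0 | hx0
      · obtain ⟨k, j, hkj⟩ := (hpn X hX).2.2.2 (fun y hy => (hsub hy).1) x hx hx0
        refine le_add_of_nonneg_of_le (Set.indicator_nonneg (fun _ _ => abs_nonneg _) _) ?_
        rw [Set.indicator_of_mem (Set.mem_range.2 ⟨(k, j), hkj.symm⟩)]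
      · exact absurd (hx0 ▸ hx) hX.2.2.1
      · obtain ⟨k, j, hkj⟩ := (hpn X hX).1.2.2 (fun y hy => (hsub hy).2) x hx hx0
        refine le_add_of_le_of_nonneg ?_ (Set.indicator_nonneg (fun _ _ => abs_nonneg _) _)
        rw [Set.indicator_of_mem (Set.mem_range.2 ⟨(k, j), hkj.symm⟩)]
    have hw : ∏ x ∈ X, realWeight q a b c x ≤ D ^ N * ∏ x ∈ X, f x := by
      rw [← hcard, ← Finset.prod_const, ← Finset.prod_mul_distrib]
      refine Finset.prod_le_prod (fun x hx => (hwpos X hX hsub x hx).le) fun x hx => ?_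
      exact (hD x (habs x (hsub hx)) (hax x (hsub hx)) (hbx x (hsub hx))).trans
        (mul_le_mul_of_nonneg_left (hxf x hx) hD0.le)
    have hC : CNconst q t ζp ζm N (X.filter (fun x => 0 < x)).card ≤ E :=
      Finset.single_le_sum (f := fun k => CNconst q t ζp ζm N k)
        (fun k _ => (CNconst_pos hq0 hq1 ht0 hζp hζm N k).le)
        (Finset.mem_range.2 (Nat.lt_succ_of_le (hcard ▸ Finset.card_filter_le _ _)))
    obtain ⟨hV0, hV⟩ := hVpos X hX hsub
    rw [hcard] at hV
    have hw0 : 0 ≤ ∏ x ∈ X, realWeight q a b c x :=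
      Finset.prod_nonneg fun x hx => (hwpos X hX hsub x hx).le
    calc W X = _ := hWeq X
      _ ≤ E * (K ^ N) ^ N * (D ^ N * ∏ x ∈ X, f x) := by gcongr
      _ = _ := by simp only [Function.comp]; ring
  have hZ : 0 < ∑' X : OmegaN q t ζp ζm N, W X := by
    obtain ⟨X, hX, hXA⟩ := exists_mem_OmegaN (q := q) (ζp := ζp) ζm ht0 ht1 hA0
      (by
        obtain ⟨n, rfl⟩ := ha
        refine ⟨1 - n, ?_⟩
        rw [hA, zpow_sub₀ hq0.ne', zpow_one]
        field_simp) hN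
    exact hsum.tsum_pos (fun Y => hnonneg Y Y.2) ⟨X, hX⟩
      (hpos X hX fun x hx => ⟨(hB0.trans (hXA x hx).1).le, (hXA x hx).2⟩)
  refine ⟨fun X hX => ⟨⟨?_, hnonneg X hX⟩, hzero X hX, hpos X hX⟩, hsum, hZ, fun X => ?_, ?_⟩
  · rw [Mtilde_eq_ofReal hq0 hq1 t ζp ζm N a b hcd X, Complex.ofReal_im]
  · refine ⟨fun h => ?_, fun h => div_pos (hpos X X.2 h) hZ⟩
    by_contra hsub
    simp [hzero X X.2 hsub] at h
  · rw [tsum_div_const]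
    exact div_self hZ.ne'
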